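/- arXiv:0901.3003 — 4 statements merged into one kernel-verified Lean document; each statement's English description precedes it below -/
import Mathlib

section
/- For every CTC term t of sort Tuplix there exists a CTC canonical term t' such that the equation t = t' is derivable from the axioms T1–T10 of CTC together with the proof rule DE. -/
/-- A signed non-trivial cancellation meadow: a commutative ring with `0 ≠ 1`,
a total multiplicative inverse operation satisfying reflexivity and the restricted
inverse law, the cancellation axiom, and a signum operation satisfying the signum
axioms.  (`u / v` abbreviates `u * minv v`.) -/
structure SignedCancellationMeadow (D : Type) [CommRing D] where
  minv : D → D
  sgn : D → D
  inv_inv : ∀ u : D, minv (minv u) = u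
  ril : ∀ u : D, u * (u * minv u) = u
  cancel : ∀ u v w : D, u ≠ 0 → u * v = u * w → v = w
  zero_ne_one : (0 : D) ≠ 1
  sgn_div_self : ∀ u : D, sgn (u * minv u) = u * minv u
  sgn_one_sub_div_self : ∀ u : D, sgn (1 - u * minv u) = 1 - u * minv u
  sgn_neg_one : sgn (-1) = -1
  sgn_inv : ∀ u : D, sgn (minv u) = sgn u
  sgn_mul : ∀ u v : D, sgn (u * v) = sgn u * sgn v
  sgn_add : ∀ u v : D,
    (1 - (sgn u - sgn v) * minv (sgn u - sgn v)) * (sgn (u + v) - sgn u) = 0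

/-- Quantity terms of CTC: built from `0`, `1`, `+`, `·`, additive inverse,
multiplicative inverse, signum, and quantity variables. -/
inductive QTerm : Type where
  | zero : QTerm
  | one : QTerm
  | add : QTerm → QTerm → QTerm
  | mul : QTerm → QTerm → QTerm
  | neg : QTerm → QTerm
  | inv : QTerm → QTerm
  | sgn : QTerm → QTerm
  | var : ℕ → QTerm

/-- `p / q` for quantity terms abbreviates `p * q⁻¹`. -/
def qdiv (p q : QTerm) : QTerm := QTerm.mul p (QTerm.inv q)

/-- `p − q` for quantity terms abbreviates `p + (−q)`. -/
def qsub (p q : QTerm) : QTerm := QTerm.add p (QTerm.neg q)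

/-- Evaluation of a quantity term in the signed cancellation meadow `D` under an
assignment `ρ` of elements of `D` to the quantity variables. -/
def evalQ {D : Type} [CommRing D] (M : SignedCancellationMeadow D) (ρ : ℕ → D) :
    QTerm → D
  | QTerm.zero => 0
  | QTerm.one => 1
  | QTerm.add p q => evalQ M ρ p + evalQ M ρ q
  | QTerm.mul p q => evalQ M ρ p * evalQ M ρ q
  | QTerm.neg p => -evalQ M ρ p
  | QTerm.inv p => M.minv (evalQ M ρ p)
  | QTerm.sgn p => M.sgn (evalQ M ρ p)
  | QTerm.var n => ρ n

/-- CTC terms of sort Tuplix over the set `A` of transfer actions: the empty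
tuplix `ε`, the blocking tuplix `δ`, transfer actions `a(p)`, zero tests `γ(p)`,
tuplix variables, and conjunctive composition `⊓`. -/
inductive CTerm (A : Type) : Type where
  | eps : CTerm A
  | dlt : CTerm A
  | act : A → QTerm → CTerm A
  | gam : QTerm → CTerm A
  | var : ℕ → CTerm A
  | conj : CTerm A → CTerm A → CTerm A

/-- Derivability of equations between CTC tuplix terms from the axioms T1–T10 in
many-sorted equational logic (reflexivity, symmetry, transitivity and congruence),
together with the proof rule DE lifting the equations between quantity terms that
are valid in the signed cancellation meadow `D`. -/
inductive CDer (A : Type) (D : Type) [CommRing D] (M : SignedCancellationMeadow D) :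
    CTerm A → CTerm A → Prop where
  | refl (x : CTerm A) : CDer A D M x x
  | symm {x y : CTerm A} : CDer A D M x y → CDer A D M y x
  | trans {x y z : CTerm A} : CDer A D M x y → CDer A D M y z → CDer A D M x z
  | conj_congr {x x' y y' : CTerm A} :
      CDer A D M x x' → CDer A D M y y' →
      CDer A D M (CTerm.conj x y) (CTerm.conj x' y')
  | act_congr (a : A) {p q : QTerm} :
      (∀ ρ : ℕ → D, evalQ M ρ p = evalQ M ρ q) →
      CDer A D M (CTerm.act a p) (CTerm.act a q)
  | de {p q : QTerm} :
      (∀ ρ : ℕ → D, evalQ M ρ p = evalQ M ρ q) →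
      CDer A D M (CTerm.gam p) (CTerm.gam q)
  | t1 (x y : CTerm A) : CDer A D M (CTerm.conj x y) (CTerm.conj y x)
  | t2 (x y z : CTerm A) :
      CDer A D M (CTerm.conj (CTerm.conj x y) z) (CTerm.conj x (CTerm.conj y z))
  | t3 (x : CTerm A) : CDer A D M (CTerm.conj x CTerm.eps) x
  | t4 (x : CTerm A) : CDer A D M (CTerm.conj x CTerm.dlt) CTerm.dlt
  | t5 (a : A) (u v : QTerm) :
      CDer A D M (CTerm.conj (CTerm.act a u) (CTerm.act a v)) (CTerm.act a (QTerm.add u v))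
  | t6 (u : QTerm) : CDer A D M (CTerm.gam u) (CTerm.gam (qdiv u u))
  | t7 : CDer A D M (CTerm.gam QTerm.zero) CTerm.eps
  | t8 : CDer A D M (CTerm.gam QTerm.one) CTerm.dlt
  | t9 (u v : QTerm) :
      CDer A D M (CTerm.conj (CTerm.gam u) (CTerm.gam v))
        (CTerm.gam (QTerm.add (qdiv u u) (qdiv v v)))
  | t10 (a : A) (u v : QTerm) :
      CDer A D M (CTerm.conj (CTerm.gam (qsub u v)) (CTerm.act a u))
        (CTerm.conj (CTerm.gam (qsub u v)) (CTerm.act a v))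

/-- The term `γ(p₀) ⊓ a₁(p₁) ⊓ … ⊓ a_k(p_k) ⊓ x₁ ⊓ … ⊓ x_l` (associated to the left),
where `as = [(a₁,p₁),…,(a_k,p_k)]` and `xs = [x₁,…,x_l]`. -/
def mkCanon {A : Type} (p0 : QTerm) (as : List (A × QTerm)) (xs : List ℕ) : CTerm A :=
  ((as.map fun ap : A × QTerm => CTerm.act ap.1 ap.2) ++ (xs.map CTerm.var)).foldl CTerm.conj
    (CTerm.gam p0)

/-- A CTC canonical term: a term of the form `γ(p₀) ⊓ a₁(p₁) ⊓ … ⊓ a_k(p_k) ⊓ x₁ ⊓ … ⊓ x_l`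
with `k, l ≥ 0` and `a₁, …, a_k` distinct transfer actions. -/
def IsCTCCanonical {A : Type} (t : CTerm A) : Prop :=
  ∃ (p0 : QTerm) (as : List (A × QTerm)) (xs : List ℕ),
    (as.map Prod.fst).Nodup ∧ t = mkCanon p0 as xs

namespace CDer

variable {A D : Type} [CommRing D] {M : SignedCancellationMeadow D}

theorem foldl_conj_congr (l : List (CTerm A)) {b b' : CTerm A} (h : CDer A D M b b') :
    CDer A D M (l.foldl CTerm.conj b) (l.foldl CTerm.conj b') := by
  induction l generalizing b b' with
  | nil => exact h
  | cons x l ih => exact ih (conj_congr h (refl x))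

theorem conj_right_comm (x y z : CTerm A) :
    CDer A D M (CTerm.conj (CTerm.conj x y) z) (CTerm.conj (CTerm.conj x z) y) :=
  (t2 x y z).trans ((conj_congr (refl x) (t1 y z)).trans (t2 x z y).symm)

theorem foldl_conj_right (l : List (CTerm A)) (b x : CTerm A) :
    CDer A D M (CTerm.conj (l.foldl CTerm.conj b) x) (l.foldl CTerm.conj (CTerm.conj b x)) := by
  induction l generalizing b with
  | nil => exact refl _
  | cons y l ih => exact (ih (CTerm.conj b y)).trans (foldl_conj_congr l (conj_right_comm b y x))

theorem exists_canonical_conj_gam {c : CTerm A} (hc : IsCTCCanonical c) (q : QTerm) :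
    ∃ c', IsCTCCanonical c' ∧ CDer A D M (CTerm.conj c (CTerm.gam q)) c' := by
  obtain ⟨p, as, xs, has, rfl⟩ := hc
  exact ⟨_, ⟨_, as, xs, has, rfl⟩,
    (foldl_conj_right _ _ _).trans (foldl_conj_congr _ (t9 p q))⟩

theorem exists_canonical_conj_act {c : CTerm A} (hc : IsCTCCanonical c) (a : A) (q : QTerm) :
    ∃ c', IsCTCCanonical c' ∧ CDer A D M (CTerm.conj c (CTerm.act a q)) c' := by
  obtain ⟨p, as, xs, has, rfl⟩ := hc
  by_cases ha : a ∈ as.map Prod.fst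
  · obtain ⟨⟨a, r⟩, hmem, rfl⟩ := List.mem_map.mp ha
    obtain ⟨l₁, l₂, rfl⟩ := List.append_of_mem hmem
    refine ⟨_, ⟨p, l₁ ++ (a, QTerm.add r q) :: l₂, xs, by simpa using has, rfl⟩, ?_⟩
    simp only [mkCanon, List.map_append, List.map_cons, List.append_assoc, List.cons_append,
      List.foldl_append, List.foldl_cons]
    rw [← List.foldl_append, ← List.foldl_append]
    exact (foldl_conj_right _ _ _).trans
      (foldl_conj_congr _ ((t2 _ _ _).trans (conj_congr (refl _) (t5 a r q))))
  · exact ⟨_, ⟨p, (a, q) :: as, xs, List.nodup_cons.mpr ⟨ha, has⟩, rfl⟩,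
      foldl_conj_right _ _ _⟩

theorem exists_canonical_conj {c : CTerm A} (hc : IsCTCCanonical c) (t : CTerm A) :
    ∃ c', IsCTCCanonical c' ∧ CDer A D M (CTerm.conj c t) c' := by
  induction t generalizing c with
  | eps => exact ⟨c, hc, t3 c⟩
  | dlt =>
    exact ⟨_, ⟨QTerm.one, [], [], List.nodup_nil, rfl⟩, (t4 c).trans t8.symm⟩
  | act a q => exact exists_canonical_conj_act hc a q
  | gam q => exact exists_canonical_conj_gam hc q
  | var n =>
    obtain ⟨p, as, xs, has, rfl⟩ := hc
    refine ⟨_, ⟨p, as, xs ++ [n], has, rfl⟩, ?_⟩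
    simp only [mkCanon, List.map_append, List.map_cons, List.map_nil, List.foldl_append,
      List.foldl_cons, List.foldl_nil]
    exact refl _
  | conj x y ihx ihy =>
    obtain ⟨d, hd, hxd⟩ := ihx hc
    obtain ⟨e, he, hye⟩ := ihy hd
    exact ⟨e, he, (t2 c x y).symm.trans ((conj_congr hxd (refl y)).trans hye)⟩

end CDer

/-- **Proposition 1.** For every CTC term `t` of sort Tuplix there exists a CTC
canonical term `t'` such that `t = t'` is derivable from the axioms T1–T10 of CTC
together with the proof rule DE. -/
theorem ctc_canonical_form (A : Type) (D : Type) [CommRing D]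
    (M : SignedCancellationMeadow D) (t : CTerm A) :
    ∃ t' : CTerm A, IsCTCCanonical t' ∧ CDer A D M t t' := by
  obtain ⟨c, hc, h⟩ := CDer.exists_canonical_conj (M := M)
    ⟨QTerm.zero, [], [], List.nodup_nil, rfl⟩ t
  exact ⟨c, hc, (CDer.t3 t).symm.trans ((CDer.t1 t CTerm.eps).trans
    ((CDer.conj_congr CDer.t7.symm (CDer.refl t)).trans h))⟩
end

section
/- In any meadow R, the cancellation axiom (for all u, v, w ∈ R, u ≠ 0 and u·v = u·w imply v = w) holds if and only if the general inverse law (for all u ∈ R, u ≠ 0 implies u·u⁻¹ = 1) holds. -/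
/-- In any meadow, the cancellation axiom holds iff the general inverse law holds. -/
theorem meadow_cancellation_iff_general_inverse_law (R : Type*) [CommRing R] (inv : R → R)
    (inv_inv : ∀ u : R, inv (inv u) = u)
    (ril : ∀ u : R, u * (u * inv u) = u) :
    (∀ u v w : R, u ≠ 0 → u * v = u * w → v = w) ↔ (∀ u : R, u ≠ 0 → u * inv u = 1) := by
  constructor
  · intro cancel u hu
    exact cancel u _ _ hu ((ril u).trans (mul_one u).symm)
  · intro gil u v w hu h
    calc v = inv u * (u * v) := by rw [← mul_assoc, mul_comm (inv u), gil u hu, one_mul]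
      _ = inv u * (u * w) := by rw [h]
      _ = w := by rw [← mul_assoc, mul_comm (inv u), gil u hu, one_mul]
end

section
/- Let R be a non-trivial cancellation meadow and let s : R → R be any unary function. Then the equation (1 − (s(u) − s(v))·(s(u) − s(v))⁻¹)·(s(u+v) − s(u)) = 0 holds for all u, v ∈ R if and only if the conditional equation 's(u) = s(v) implies s(u+v) = s(u)' holds for all u, v ∈ R. -/
/-- In a non-trivial cancellation meadow, the equational signum axiom
`(1 − (s(u) − s(v))·(s(u) − s(v))⁻¹)·(s(u+v) − s(u)) = 0` is equivalent to the
conditional equation `s(u) = s(v) → s(u+v) = s(u)`. -/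
theorem meadow_sign_axiom_iff (R : Type*) [CommRing R] (inv : R → R)
    (inv_inv : ∀ u : R, inv (inv u) = u)
    (ril : ∀ u : R, u * (u * inv u) = u)
    (cancel : ∀ u v w : R, u ≠ 0 → u * v = u * w → v = w)
    (nontrivial : (0 : R) ≠ 1)
    (s : R → R) :
    (∀ u v : R, (1 - (s u - s v) * inv (s u - s v)) * (s (u + v) - s u) = 0) ↔
      (∀ u v : R, s u = s v → s (u + v) = s u) := by
  refine ⟨fun h u v huv => ?_, fun h u v => ?_⟩
  · have := h u v
    rw [huv, sub_self, zero_mul, sub_zero, one_mul] at this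
    rw [huv]
    exact sub_eq_zero.mp this
  · by_cases huv : s u = s v
    · rw [h u v huv, sub_self, mul_zero]
    · have hinv : (s u - s v) * inv (s u - s v) = 1 :=
        cancel _ _ _ (sub_ne_zero.mpr huv) ((ril _).trans (mul_one _).symm)
      rw [hinv, sub_self, zero_mul]
end

section
/- Define IC : ℚ → List ℚ → ℚ by IC r [] = 0 and IC r (c :: l) = max(c + (1/(1+r))·IC r l, 0). Then for every rational r with r > −1 and all lists l and l' of rational numbers of the same length, IC r (zipWith (+) l l') ≤ IC r l + IC r l'. -/
/-- The implicit capital of a financial behaviour given as a list of transfers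
(one per time slice), at interest rate `r` per time slice. -/
def IC (r : ℚ) : List ℚ → ℚ
  | [] => 0
  | c :: l => max (c + (1 / (1 + r)) * IC r l) 0

theorem IC_nonneg (r : ℚ) (l : List ℚ) : 0 ≤ IC r l := by
  cases l with
  | nil => exact le_rfl
  | cons c l => exact le_max_right _ _

/-- Subadditivity of implicit capital: the implicit capital of a joint behaviour is
at most the sum of the implicit capitals of the two component behaviours. -/
theorem IC_zipWith_add_le (r : ℚ) (hr : -1 < r) (l l' : List ℚ)
    (hlen : l.length = l'.length) :
    IC r (List.zipWith (· + ·) l l') ≤ IC r l + IC r l' := by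
  induction l generalizing l' with
  | nil => simpa [IC] using IC_nonneg r l'
  | cons c l ih =>
    cases l' with
    | nil => simp at hlen
    | cons c' l' =>
      have hq : 0 ≤ 1 / (1 + r) := one_div_nonneg.mpr (by linarith)
      have h := mul_le_mul_of_nonneg_left (ih l' (by simpa using hlen)) hq
      simp only [List.zipWith_cons_cons, IC]
      refine max_le ?_ (add_nonneg (le_max_right _ _) (le_max_right _ _))
      refine le_trans ?_ (add_le_add (le_max_left _ _) (le_max_left _ _))
      linarith
end
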